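/- arXiv:2506.07299 — 2 statements merged into one kernel-verified Lean document; each statement's English description precedes it below -/
import Mathlib

section
/- Let λ > 0, μ ∈ ℝ, σ > 0, N ≥ 1, and let μ̂ and ΔS be independent real random variables with laws Gaussian of mean μ and variance σ²/N, and Gaussian of mean μ and variance σ², respectively. Set x = N/(λσ²(N + 1)), so that the mixture strategy is a_mix = x·μ̂. Then the out-of-sample performance of the mixture strategy satisfies 𝔼[a_mix·ΔS] − (λ/2)·Var(a_mix·ΔS) = x·μ²·(1 − λ·x·σ²/2) − (λ/(2N))·x²·σ²·(μ² + σ²). -/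
open MeasureTheory ProbabilityTheory
open scoped NNReal

lemma gauss_facts {Ω : Type*} [MeasurableSpace Ω] (P : Measure Ω) [IsProbabilityMeasure P]
    (μ : ℝ) (v : ℝ≥0) (X : Ω → ℝ) (h : Measure.map X P = gaussianReal μ v) :
    MemLp X 2 P ∧ ∫ ω, X ω ∂P = μ ∧ ∫ ω, X ω ^ 2 ∂P = μ ^ 2 + v := by
  have hm : AEMeasurable X P := by
    by_contra hc
    rw [Measure.map_of_not_aemeasurable hc] at h
    exact IsProbabilityMeasure.ne_zero (gaussianReal μ v) h.symm
  have hl : HasLaw X (gaussianReal μ v) P := ⟨hm, h⟩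
  have h2 : MemLp X 2 P := by
    have h3 := memLp_id_gaussianReal' (μ := μ) (v := v) 2 (by simp)
    rw [← h] at h3
    exact (memLp_map_measure_iff (by fun_prop) hm).1 h3
  have hi : ∫ ω, X ω ∂P = μ := by
    rw [hl.integral_eq, integral_id_gaussianReal]
  refine ⟨h2, hi, ?_⟩
  have hv := hl.variance_eq
  rw [variance_id_gaussianReal, variance_eq_sub h2, hi] at hv
  simp only [Pi.pow_apply] at hv
  linarith

/-- Out-of-sample mean-variance performance of the mixture strategy
`a_mix = x·μ̂` with `x = N/(λσ²(N+1))`. -/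
theorem oosp_mixture
    {Ω : Type*} [MeasurableSpace Ω] (P : Measure Ω) [IsProbabilityMeasure P]
    (lam μ σ : ℝ) (hlam : 0 < lam) (hσ : 0 < σ) (N : ℕ) (hN : 1 ≤ N)
    (muHat ΔS : Ω → ℝ) (hIndep : IndepFun muHat ΔS P)
    (hmu : Measure.map muHat P = gaussianReal μ ⟨σ ^ 2 / N, by positivity⟩)
    (hS : Measure.map ΔS P = gaussianReal μ ⟨σ ^ 2, sq_nonneg σ⟩)
    (x : ℝ) (hx : x = N / (lam * σ ^ 2 * (N + 1))) :
    (∫ ω, x * muHat ω * ΔS ω ∂P)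
        - lam / 2 * variance (fun ω => x * muHat ω * ΔS ω) P
      = x * μ ^ 2 * (1 - lam * x * σ ^ 2 / 2)
        - lam / (2 * N) * x ^ 2 * σ ^ 2 * (μ ^ 2 + σ ^ 2) := by
  obtain ⟨hX, hX1, hX2⟩ := gauss_facts P _ _ _ hmu
  obtain ⟨hY, hY1, hY2⟩ := gauss_facts P _ _ _ hS
  have hsq : IndepFun (fun ω => muHat ω ^ 2) (fun ω => ΔS ω ^ 2) P :=
    hIndep.comp (φ := fun y : ℝ => y ^ 2) (ψ := fun y : ℝ => y ^ 2) (by fun_prop) (by fun_prop)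
  have h1 : ∫ ω, x * muHat ω * ΔS ω ∂P = x * (μ * μ) := by
    simp_rw [mul_assoc]
    rw [integral_const_mul, hIndep.integral_fun_mul_eq_mul_integral
      hX.aestronglyMeasurable hY.aestronglyMeasurable, hX1, hY1]
  have e : ∀ ω, (x * muHat ω * ΔS ω) ^ 2 = x ^ 2 * (muHat ω ^ 2 * ΔS ω ^ 2) := fun ω => by ring
  have h2 : ∫ ω, (x * muHat ω * ΔS ω) ^ 2 ∂P
      = x ^ 2 * ((μ ^ 2 + σ ^ 2 / N) * (μ ^ 2 + σ ^ 2)) := by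
    simp_rw [e]
    rw [integral_const_mul, hsq.integral_fun_mul_eq_mul_integral
      hX.integrable_sq.aestronglyMeasurable hY.integrable_sq.aestronglyMeasurable, hX2, hY2]
    rfl
  have hL : MemLp (fun ω => x * muHat ω * ΔS ω) 2 P := by
    refine (memLp_two_iff_integrable_sq
      ((hX.aestronglyMeasurable.const_mul x).mul hY.aestronglyMeasurable)).2 ?_
    change Integrable (fun ω => (x * muHat ω * ΔS ω) ^ 2) P
    simp_rw [e]
    exact (hsq.integrable_mul hX.integrable_sq hY.integrable_sq).const_mul _
  rw [variance_eq_sub hL]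
  simp only [Pi.pow_apply]
  rw [h1, h2]
  have : (N : ℝ) ≠ 0 := by positivity
  clear hx
  field_simp
  ring
end

section
/- Let λ > 0, λ' > 0, μ ∈ ℝ, σ > 0, N ≥ 1, and set x_N = λN/(λN + λ'). Let μ̂ and ΔS be independent real random variables with laws Gaussian of mean μ and variance σ²/N, and Gaussian of mean μ and variance σ², respectively, and let a_u-a = x_N·μ̂/(λσ²). Then the out-of-sample performance of the entropic uncertainty-aware strategy satisfies 𝔼[a_u-a·ΔS] − (λ/2)·Var(a_u-a·ΔS) = (x_N/(λσ²))·(μ²·(1 − x_N/2) − x_N·(μ² + σ²)/(2N)). -/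
open MeasureTheory ProbabilityTheory
open scoped NNReal

theorem gaussian_moments_aux {Ω : Type*} [MeasurableSpace Ω] (P : Measure Ω)
    [IsProbabilityMeasure P] (X : Ω → ℝ) (m : ℝ) (v : ℝ≥0)
    (h : Measure.map X P = gaussianReal m v) :
    MemLp X 2 P ∧ ∫ ω, X ω ∂P = m ∧ ∫ ω, X ω ^ 2 ∂P = m ^ 2 + v := by
  have hX : AEMeasurable X P := by
    by_contra hc
    rw [Measure.map_of_not_aemeasurable hc] at h
    exact IsProbabilityMeasure.ne_zero (gaussianReal m v) h.symm
  have hL : MemLp X 2 P := by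
    have h1 : MemLp id 2 (Measure.map X P) := by
      rw [h]; exact memLp_id_gaussianReal' 2 (by simp)
    exact (memLp_map_measure_iff h1.1 hX).1 h1
  have hE : ∫ ω, X ω ∂P = m := by
    have := integral_map hX (f := fun x : ℝ => x) (by fun_prop)
    rw [← this, h, integral_id_gaussianReal]
  have hV : variance X P = v := by
    have := variance_map (X := id) (Y := X) (μ := P) (by fun_prop) hX
    rw [h, variance_id_gaussianReal] at this
    exact this.symm
  refine ⟨hL, hE, ?_⟩
  have h2 := variance_eq_sub hL
  rw [hV] at h2
  simp only [Pi.pow_apply] at h2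
  rw [hE] at h2
  linarith

/-- Out-of-sample mean-variance performance of the entropic
uncertainty-aware strategy `a_u-a = x_N·μ̂/(λσ²)` with `x_N = λN/(λN + λ')`. -/
theorem oosp_entropic_uncertainty_aware
    {Ω : Type*} [MeasurableSpace Ω] (P : Measure Ω) [IsProbabilityMeasure P]
    (lam lam' μ σ : ℝ) (hlam : 0 < lam) (hlam' : 0 < lam') (hσ : 0 < σ)
    (N : ℕ) (hN : 1 ≤ N)
    (muHat ΔS : Ω → ℝ) (hIndep : IndepFun muHat ΔS P)
    (hmu : Measure.map muHat P = gaussianReal μ ⟨σ ^ 2 / N, by positivity⟩)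
    (hS : Measure.map ΔS P = gaussianReal μ ⟨σ ^ 2, sq_nonneg σ⟩)
    (xN : ℝ) (hxN : xN = lam * N / (lam * N + lam')) :
    (∫ ω, xN * muHat ω / (lam * σ ^ 2) * ΔS ω ∂P)
        - lam / 2 * variance (fun ω => xN * muHat ω / (lam * σ ^ 2) * ΔS ω) P
      = xN / (lam * σ ^ 2)
          * (μ ^ 2 * (1 - xN / 2) - xN * (μ ^ 2 + σ ^ 2) / (2 * N)) := by
  obtain ⟨hX, hX1, hX2⟩ := gaussian_moments_aux P muHat _ _ hmu
  obtain ⟨hY, hY1, hY2⟩ := gaussian_moments_aux P ΔS _ _ hS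
  have hN0 : (N : ℝ) ≠ 0 := by
    have : N ≠ 0 := by omega
    exact_mod_cast this
  have hI2 : IndepFun (fun ω => muHat ω ^ 2) (fun ω => ΔS ω ^ 2) P :=
    hIndep.comp (φ := fun x : ℝ => x ^ 2) (ψ := fun x : ℝ => x ^ 2)
      (by fun_prop) (by fun_prop)
  have hE : ∫ ω, muHat ω * ΔS ω ∂P = μ * μ := by
    rw [hIndep.integral_fun_mul_eq_mul_integral hX.1 hY.1, hX1, hY1]
  have hE2 : ∫ ω, (muHat ω * ΔS ω) ^ 2 ∂P = (μ ^ 2 + σ ^ 2 / N) * (μ ^ 2 + σ ^ 2) := by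
    simp only [mul_pow]
    rw [hI2.integral_fun_mul_eq_mul_integral hX.integrable_sq.1 hY.integrable_sq.1, hX2, hY2]
    rfl
  have hL : MemLp (fun ω => muHat ω * ΔS ω) 2 P := by
    refine (memLp_two_iff_integrable_sq (hX.1.mul hY.1)).2 ?_
    have := hI2.integrable_mul hX.integrable_sq hY.integrable_sq
    refine this.congr (Filter.Eventually.of_forall fun ω => ?_)
    simp [mul_pow]
  have hV := variance_eq_sub hL
  simp only [Pi.pow_apply] at hV
  rw [hE2, hE] at hV
  have hf : (fun ω => xN * muHat ω / (lam * σ ^ 2) * ΔS ω)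
      = fun ω => xN / (lam * σ ^ 2) * (muHat ω * ΔS ω) := by
    funext ω; ring
  rw [hf, integral_const_mul, variance_const_mul, hV, hE]
  clear hxN
  field_simp
  ring
end
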